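/- Let 𝒫 be a graded poset for which there exists an adequate local covering family. Then the alternating sum of the ranks of the integral cohomology groups of 𝒫 satisfies Σ_i (−1)^i rk H^i(𝒫; ℤ) = Σ_i (−1)^i Σ_{p ∈ Ob_i(𝒫)} R_i^p. -/

import Mathlib

open Finset

/-- A graded poset (with the standing assumptions of Remark 2.5: the degree function is
order-reversing, adds one along preceding pairs, takes nonnegative values, and every
up-set is finite). -/
structure GradedPoset (P : Type) [PartialOrder P] : Type where
  deg : P → ℤ
  deg_antitone : ∀ ⦃p q : P⦄, p ≤ q → deg q ≤ deg p
  deg_step : ∀ ⦃p q : P⦄, p < q → (∀ r, p ≤ r → r ≤ q → r = p ∨ r = q) → deg p = deg q + 1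
  deg_nonneg : ∀ p, 0 ≤ deg p
  finite_up : ∀ p : P, {q : P | p ≤ q}.Finite

/-- A functor from a poset `P` to the category `Ab` of abelian groups. -/
structure PosetFunctor (P : Type) [PartialOrder P] : Type 1 where
  obj : P → Type
  grp : ∀ p, AddCommGroup (obj p)
  map : ∀ {p q : P}, p ≤ q → obj p →+ obj q
  map_id : ∀ (p : P) (x : obj p), map (le_refl p) x = x
  map_comp : ∀ {p q r : P} (h₁ : p ≤ q) (h₂ : q ≤ r) (x : obj p),
    map h₂ (map h₁ x) = map (h₁.trans h₂) x

attribute [instance] PosetFunctor.grp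

variable {P : Type} [PartialOrder P]

/-- A natural transformation between functors `P → Ab`. -/
structure PosetHom (F G : PosetFunctor P) : Type where
  app : ∀ p : P, F.obj p →+ G.obj p
  naturality : ∀ {p q : P} (h : p ≤ q) (x : F.obj p),
    G.map h (app p x) = app q (F.map h x)

/-- The constant functor with value `ℤ`. -/
def constZ (P : Type) [PartialOrder P] : PosetFunctor P where
  obj _ := ℤ
  grp _ := inferInstance
  map _ := AddMonoidHom.id ℤ
  map_id _ _ := rfl
  map_comp _ _ _ := rfl

namespace PosetFunctor

/-- The inverse limit `lim F` of `F : P → Ab`, realized as the group of compatible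
families (sections). -/
def sections (F : PosetFunctor P) : AddSubgroup (∀ p, F.obj p) where
  carrier := {x | ∀ (p q : P) (h : p ≤ q), F.map h (x p) = x q}
  zero_mem' := by intro p q h; simp
  add_mem' := by intro a b ha hb p q h; simp [map_add, ha p q h, hb p q h]
  neg_mem' := by intro a ha p q h; simp [ha p q h]

/-- The functor `F'` with `F'(p₀) = ∏_{p₀ ≤ p} F(p)`; a morphism `p₁ ≤ p₀` acts by
sending the factor indexed by `p₁ ≤ p` identically to the factor indexed by `p₀ ≤ p`
when `p₀ ≤ p`, and by zero otherwise. -/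
def prime (F : PosetFunctor P) : PosetFunctor P where
  obj p₀ := ∀ q : {q : P // p₀ ≤ q}, F.obj q.1
  grp _ := inferInstance
  map h := AddMonoidHom.mk' (fun x q => x ⟨q.1, h.trans q.2⟩) (fun _ _ => rfl)
  map_id _ _ := rfl
  map_comp _ _ _ := rfl

end PosetFunctor

/-- The subgroup `Ker_F(p₀) = ⋂_{p₀ < q} Ker (F(p₀ → q))`. -/
def kerAt (F : PosetFunctor P) (p₀ : P) : AddSubgroup (F.obj p₀) where
  carrier := {x | ∀ (q : P) (h : p₀ < q), F.map h.le x = 0}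
  zero_mem' := by intro q h; simp
  add_mem' := by intro a b ha hb q h; simp [map_add, ha q h, hb q h]
  neg_mem' := by intro a ha q h; simp [ha q h]

/-- `F` is `n`-condensed: `F(p) = 0` for `deg p < n` and `Ker_F(p) = 0` for `deg p > n`. -/
def IsCondensed (G : GradedPoset P) (F : PosetFunctor P) (n : ℕ) : Prop :=
  (∀ p : P, G.deg p < (n : ℤ) → ∀ x : F.obj p, x = 0) ∧
  (∀ p : P, (n : ℤ) < G.deg p → ∀ x ∈ kerAt F p, x = 0)

/-- The set `(p₀ ↓ P)_n` of objects above `p₀` of degree `n`. -/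
def degSet (G : GradedPoset P) (p₀ : P) (n : ℕ) : Set P :=
  {q : P | p₀ ≤ q ∧ G.deg q = (n : ℤ)}

/-- The functor `Ker'_F` (for an `n`-condensed functor `F`):
`Ker'_F(p₀) = ∏_{p ∈ (p₀↓P)_n} F(p)`. -/
def kerPrime (G : GradedPoset P) (F : PosetFunctor P) (n : ℕ) : PosetFunctor P where
  obj p₀ := ∀ q : degSet G p₀ n, F.obj q.1
  grp _ := inferInstance
  map h := AddMonoidHom.mk' (fun x q => x ⟨q.1, h.trans q.2.1, q.2.2⟩) (fun _ _ => rfl)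
  map_id _ _ := rfl
  map_comp _ _ _ := rfl

/-- The natural transformation `λ : F ⇒ Ker'_F` with components
`λ_{p₀} = ∏_{p ∈ (p₀↓P)_n} F(p₀ → p)`. -/
def lambdaNT (G : GradedPoset P) (F : PosetFunctor P) (n : ℕ) :
    PosetHom F (kerPrime G F n) where
  app p₀ := AddMonoidHom.mk' (fun x q => F.map q.2.1 x)
    (by intro a b; funext q; exact map_add _ a b)
  naturality := by
    intro p q h x
    funext r
    exact (F.map_comp h r.2.1 x).symm

/-! ### The cochain complex computing higher inverse limits -/

/-- Composable chains `p₀ ≤ p₁ ≤ … ≤ pₙ` in `P`. -/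
def ChainP (P : Type) [PartialOrder P] (n : ℕ) : Type :=
  {c : Fin (n + 1) → P // Monotone c}

/-- `n`-cochains of the cobar complex computing the derived functors of `lim` over `P`
with coefficients in `F`. -/
abbrev cochain (F : PosetFunctor P) (n : ℕ) : Type :=
  ∀ c : ChainP P n, F.obj (c.1 (Fin.last n))

/-- The `i`-th face of a chain. -/
def chainFace {n : ℕ} (i : Fin (n + 2)) (c : ChainP P (n + 1)) : ChainP P n :=
  ⟨c.1 ∘ i.succAbove, c.2.comp (Fin.strictMono_succAbove i).monotone⟩

/-- The differential of the cobar complex. -/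
noncomputable def cobarDiff (F : PosetFunctor P) (n : ℕ) : cochain F n →+ cochain F (n + 1) :=
  AddMonoidHom.mk'
    (fun ψ c => ∑ i : Fin (n + 2),
      ((-1 : ℤ) ^ (i : ℕ)) • F.map (c.2 (Fin.le_last (i.succAbove (Fin.last n))))
        (ψ (chainFace i c)))
    (by
      intro a b; funext c
      refine (Finset.sum_congr rfl fun i _ => ?_).trans Finset.sum_add_distrib
      exact (congrArg (((-1 : ℤ) ^ (i : ℕ)) • ·)
        (map_add (F.map (c.2 (Fin.le_last (i.succAbove (Fin.last n)))))
          (a (chainFace i c)) (b (chainFace i c)))).trans (smul_add _ _ _))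

/-- Coboundaries of the cobar complex. -/
noncomputable def cobarCoboundaries (F : PosetFunctor P) : ∀ n : ℕ, AddSubgroup (cochain F n)
  | 0 => ⊥
  | n + 1 => (cobarDiff F n).range

/-- `H^n(P; F) = lim^n F`, the cohomology of `P` with coefficients in `F`, computed by
the cobar complex. -/
noncomputable def cohomologyOf (F : PosetFunctor P) (n : ℕ) : Type :=
  (cobarDiff F n).ker ⧸ ((cobarCoboundaries F n).addSubgroupOf (cobarDiff F n).ker)

noncomputable instance (F : PosetFunctor P) (n : ℕ) : AddCommGroup (cohomologyOf F n) :=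
  inferInstanceAs (AddCommGroup (_ ⧸ _))

/-- The `n`-th Betti number of `P` with coefficients in `F`: the rank of `H^n(P;F)`. -/
noncomputable def bettiOf (F : PosetFunctor P) (n : ℕ) : ℕ :=
  Module.finrank ℤ (cohomologyOf F n)

/-! ### Free functors, pure maps, local covering families -/

/-- A functor is free if all its values are finitely generated free abelian groups. -/
def IsFreeFunctor (F : PosetFunctor P) : Prop :=
  ∀ p : P, Module.Free ℤ (F.obj p) ∧ Module.Finite ℤ (F.obj p)

/-- A map of abelian groups is pure if its cokernel is a free abelian group. -/
def IsPureHom {A B : Type} [AddCommGroup A] [AddCommGroup B] (f : A →+ B) : Prop :=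
  Module.Free ℤ (B ⧸ f.range)

/-- Sections of `F` over a subset `S ⊆ P`, i.e. `lim_S F`. -/
def sectionsOnSet (F : PosetFunctor P) (S : Set P) : Set (∀ q : S, F.obj q.1) :=
  {x | ∀ (q r : S) (h : q.1 ≤ r.1), F.map h (x q) = x r}

/-- The restriction map `lim_{(p₀↓P)_*} F → ∏_{q ∈ S} F(q)` (for `S` a set of objects
strictly above `p₀`, realized by intersecting with `{q | p₀ < q}`). -/
def limRestriction (F : PosetFunctor P) (p₀ : P) (S : Set P) :
    ↥(sectionsOnSet F {q : P | p₀ < q}) → ∀ q : ↥(S ∩ {q : P | p₀ < q}), F.obj q.1 :=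
  fun x q => x.1 ⟨q.1, q.2.2⟩

/-- The map `F(p₀) → ∏_{q ∈ S} F(q)` (for `S` a set of objects above `p₀`, realized by
intersecting with `{q | p₀ ≤ q}`). -/
def detMap (F : PosetFunctor P) (p₀ : P) (S : Set P) :
    F.obj p₀ →+ ∀ q : ↥(S ∩ {q : P | p₀ ≤ q}), F.obj q.1 :=
  AddMonoidHom.mk' (fun x q => F.map q.2.2 x) (by intro a b; funext q; exact map_add _ a b)

/-- A local covering family `𝒥 = {J_n^{p₀}}` (Definition 3.4). -/
def IsLCF (G : GradedPoset P) (J : P → ℕ → Set P) : Prop :=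
  (∀ (p : P) (m : ℕ), J p m ⊆ degSet G p m) ∧
  (∀ (p : P) (m : ℕ), (m : ℤ) < G.deg p →
    (⋃ r ∈ J p (m + 1), degSet G r m) = degSet G p m) ∧
  (∀ (p : P) (m : ℕ), ∀ r ∈ J p (m + 1), J r m ⊆ J p m)

/-- `F` (an `n`-condensed free functor) is `𝒥`-determined (Definition 3.5). -/
def IsDetermined (G : GradedPoset P) (J : P → ℕ → Set P) (F : PosetFunctor P) (n : ℕ) :
    Prop :=
  (∀ p₀ : P, (n : ℤ) + 1 < G.deg p₀ →
    Function.Injective (limRestriction F p₀ (J p₀ n)) ∧ IsPureHom (detMap F p₀ (J p₀ n))) ∧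
  (∀ p₀ : P, G.deg p₀ = (n : ℤ) + 1 →
    IsPureHom (detMap F p₀ (J p₀ n)) ∧ Function.Injective (detMap F p₀ (J p₀ n)))

/-- The finite set `(p↓P)_n`. -/
noncomputable def degFinset (G : GradedPoset P) (p : P) (n : ℕ) : Finset P :=
  ((G.finite_up p).subset
    (show degSet G p n ⊆ {q : P | p ≤ q} from fun _ hq => hq.1)).toFinset

/-- The numbers `R_n^{p₀}` (Definition 4.1). -/
noncomputable def Rnum (G : GradedPoset P) : ℕ → P → ℤ
  | 0, _ => 1
  | m + 1, p => (∑ q ∈ degFinset G p m, Rnum G m q) - Rnum G m p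

/-- The finite set `J_n^p` (as a `Finset`, using finiteness of up-sets). -/
noncomputable def JFinset (G : GradedPoset P) (J : P → ℕ → Set P) (p : P) (n : ℕ) :
    Finset P :=
  ((G.finite_up p).inter_of_left (J p n)).toFinset

/-- Connectedness of a subset of a poset, viewed as a full subcategory. -/
def IsConnectedSet (S : Set P) : Prop :=
  S.Nonempty ∧ ∀ a b : S, Relation.ReflTransGen (fun x y : S => x.1 ≤ y.1 ∨ y.1 ≤ x.1) a b

/-- An adequate local covering family (Definition 4.2). -/
def IsAdequate (G : GradedPoset P) (J : P → ℕ → Set P) : Prop :=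
  IsLCF G J ∧
  (∀ p : P, 2 ≤ G.deg p → IsConnectedSet {q : P | p < q}) ∧
  (∀ (m : ℕ) (p : P), (m : ℤ) + 1 ≤ G.deg p →
    Rnum G m p = ∑ q ∈ JFinset G J p m, Rnum G m q)

/-! ### The global complex and global covering families -/

/-- Restriction of a product of abelian groups to a subset of the index set. -/
def restrictTo {ι : Type} {A : ι → Type} [∀ i, AddCommGroup (A i)] (S : Set ι) :
    (∀ i, A i) →+ ∀ i : S, A i.1 :=
  AddMonoidHom.mk' (fun x i => x i.1) (fun _ _ => rfl)

open Classical in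
/-- Extension by zero of a family indexed by a subset of the index set. -/
noncomputable def extendZero {ι : Type} {A : ι → Type} [∀ i, AddCommGroup (A i)]
    (S : Set ι) : (∀ i : S, A i.1) →+ ∀ i, A i :=
  AddMonoidHom.mk' (fun x i => if h : i ∈ S then x ⟨i, h⟩ else 0)
    (by intro a b; funext i; by_cases h : i ∈ S <;> simp [h])

/-- The map on full products induced by a natural transformation
`π : Ker'_F ⇒ F'` (the building block of the differential `d = ι ∘ ω`). -/
noncomputable def dhat (G : GradedPoset P) {F F' : PosetFunctor P} (n : ℕ)
    (π : PosetHom (kerPrime G F n) F') : (∀ p : P, F.obj p) →+ ∀ p : P, F'.obj p :=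
  AddMonoidHom.mk' (fun x p => π.app p (fun q => x q.1))
    (by intro a b; funext p; exact map_add (π.app p) _ _)

/-- The set `Ob_n(P)` of objects of degree `n`. -/
def obSet (G : GradedPoset P) (n : ℕ) : Set P := {p : P | G.deg p = (n : ℤ)}

/-- The differential `d_n = ι_{n+1} ∘ ω_{n+1} : ∏_{Ob_n} F_n(p) → ∏_{Ob_{n+1}} F_{n+1}(p)`. -/
noncomputable def obDiff (G : GradedPoset P) (F : ℕ → PosetFunctor P)
    (π : ∀ n : ℕ, PosetHom (kerPrime G (F n) n) (F (n + 1))) (n : ℕ) :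
    (∀ p : ↥(obSet G n), (F n).obj p.1) →+ ∀ p : ↥(obSet G (n + 1)), (F (n + 1)).obj p.1 :=
  (restrictTo (obSet G (n + 1))).comp ((dhat G n (π n)).comp (extendZero (obSet G n)))

/-- The composite `∏_{p ∈ Ob_n(P)∖K_n} F_n(p) → ∏_{p ∈ K_{n+1}} F_{n+1}(p)`
induced by the differential. -/
noncomputable def wMap (G : GradedPoset P) (F : ℕ → PosetFunctor P)
    (π : ∀ n : ℕ, PosetHom (kerPrime G (F n) n) (F (n + 1))) (K : ℕ → Set P) (n : ℕ) :
    (∀ p : ↥(obSet G n \ K n), (F n).obj p.1) →+ ∀ p : ↥(K (n + 1)), (F (n + 1)).obj p.1 :=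
  (restrictTo (K (n + 1))).comp ((dhat G n (π n)).comp (extendZero (obSet G n \ K n)))

/-- A global covering family (Definition 5.1). -/
def IsGCF (G : GradedPoset P) (F : ℕ → PosetFunctor P)
    (π : ∀ n : ℕ, PosetHom (kerPrime G (F n) n) (F (n + 1))) (K : ℕ → Set P) : Prop :=
  (∀ n : ℕ, K n ⊆ obSet G n) ∧
  (∀ n : ℕ, Function.Injective
    (fun (s : ↥(PosetFunctor.sections (F n))) => (fun p : ↥(K n) => s.1 p.1))) ∧
  (∀ n : ℕ, IsPureHom (wMap G F π K n))

/-- `Ob_n(P)` as a `Finset` (given that each degree level is finite). -/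
noncomputable def obFinset (G : GradedPoset P)
    (hfin : ∀ i : ℤ, {p : P | G.deg p = i}.Finite) (n : ℕ) : Finset P :=
  (hfin (n : ℤ)).toFinset

/-- `K_n` as a `Finset`. -/
noncomputable def KFinset (G : GradedPoset P)
    (hfin : ∀ i : ℤ, {p : P | G.deg p = i}.Finite) (K : ℕ → Set P) (n : ℕ) : Finset P :=
  ((hfin (n : ℤ)).inter_of_left (K n)).toFinset

/-- The Betti numbers `b_n^𝒦` of a global covering family (Definition 5.2). -/
noncomputable def bettiK (G : GradedPoset P)
    (hfin : ∀ i : ℤ, {p : P | G.deg p = i}.Finite) (K : ℕ → Set P) : ℕ → ℤ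
  | 0 => ∑ p ∈ KFinset G hfin K 0, Rnum G 0 p
  | n + 1 =>
      (∑ p ∈ KFinset G hfin K n, Rnum G n p) - (∑ p ∈ obFinset G hfin n, Rnum G n p) +
        ∑ p ∈ KFinset G hfin K (n + 1), Rnum G (n + 1) p

/-- The sequence of functors `F_0 = c_ℤ, F_1, F_2, …` of Proposition 4.3, together with
the connecting short exact sequences `0 → F_{n-1} → Ker'_{F_{n-1}} → F_n → 0` and all
their properties. -/
structure CondensedSequence (G : GradedPoset P) (J : P → ℕ → Set P) : Type 1 where
  F : ℕ → PosetFunctor P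
  pi : ∀ n : ℕ, PosetHom (kerPrime G (F n) n) (F (n + 1))
  F_zero : F 0 = constZ P
  pi_surj : ∀ (n : ℕ) (p : P), Function.Surjective ((pi n).app p)
  pi_ker : ∀ (n : ℕ) (p : P), ((pi n).app p).ker = ((lambdaNT G (F n) n).app p).range
  condensed : ∀ n : ℕ, IsCondensed G (F n) n
  free : ∀ n : ℕ, IsFreeFunctor (F n)
  determined : ∀ n : ℕ, IsDetermined G J (F n) n
  rank_eq : ∀ (n : ℕ) (p : P), (n : ℤ) ≤ G.deg p →
    (Module.finrank ℤ ((F n).obj p) : ℤ) = Rnum G n p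

/-! ### Simplex-like posets -/

/-- The poset `Δ_n` of faces of the standard `n`-dimensional simplex, ordered by
inclusion: faces are the nonempty subsets of the vertex set. -/
def SimplexPoset (n : ℕ) : Type := {s : Finset (Fin (n + 1)) // s.Nonempty}

instance (n : ℕ) : PartialOrder (SimplexPoset n) := Subtype.partialOrder _

/-- A poset `P` is simplex-like (with dimension function `d`) if for every `p` the
category `(P ↓ p)` is isomorphic to `Δ_{d p}`. -/
def SimplexLike (P : Type) [PartialOrder P] (d : P → ℕ) : Prop :=
  ∀ p : P, Nonempty ({q : P // q ≤ p} ≃o SimplexPoset (d p))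


open CategoryTheory in
/-- The cosimplicial group of integral cochains on weak chains, viewed as a simplicial object
of the opposite category. -/
noncomputable def cochainObj (P : Type) [PartialOrder P] :
    SimplicialObject (ModuleCat ℤ)ᵒᵖ where
  obj Δ := Opposite.op (ModuleCat.of ℤ (ChainP P Δ.unop.len → ℤ))
  map f := (ModuleCat.ofHom (LinearMap.funLeft ℤ ℤ
    (fun c => ⟨c.1 ∘ f.unop.toOrderHom, c.2.comp f.unop.toOrderHom.monotone⟩))).op
  map_id _ := rfl
  map_comp _ _ := rfl

/-- The cobar differential with constant coefficients as a linear map. -/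
noncomputable def dLin (P : Type) [PartialOrder P] (n : ℕ) :
    (ChainP P n → ℤ) →ₗ[ℤ] (ChainP P (n + 1) → ℤ) :=
  ∑ i : Fin (n + 2), (-1 : ℤ) ^ (i : ℕ) • LinearMap.funLeft ℤ ℤ (chainFace i)

/-- Degeneracies of chains. -/
def chainDegen {n : ℕ} (i : Fin (n + 1)) (c : ChainP P n) : ChainP P (n + 1) :=
  ⟨c.1 ∘ i.predAbove, c.2.comp (Fin.predAbove_right_monotone i)⟩

open CategoryTheory in
theorem unop_sum_hom {X Y : (ModuleCat ℤ)ᵒᵖ} {ι : Type} (s : Finset ι) (f : ι → (X ⟶ Y)) :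
    (∑ i ∈ s, f i).unop.hom = ∑ i ∈ s, (f i).unop.hom := by
  rw [CategoryTheory.unop_sum, ModuleCat.hom_sum]

open CategoryTheory in
theorem unop_sum_apply {X Y : (ModuleCat ℤ)ᵒᵖ} {ι : Type} (s : Finset ι) (f : ι → (X ⟶ Y))
    (x : Y.unop) : (∑ i ∈ s, f i).unop.hom x = ∑ i ∈ s, (f i).unop.hom x := by
  rw [unop_sum_hom, LinearMap.sum_apply]

open CategoryTheory AlgebraicTopology AlgebraicTopology.DoldKan in
theorem dLin_eq (P : Type) [PartialOrder P] (n : ℕ) :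
    ((AlternatingFaceMapComplex.obj (cochainObj P)).d (n + 1) n).unop.hom = dLin P n := by
  rw [AlternatingFaceMapComplex.obj_d_eq]
  refine (unop_sum_hom _ _).trans ?_
  rfl

open CategoryTheory AlgebraicTopology AlgebraicTopology.DoldKan Simplicial in
theorem exists_normalization (P : Type) [PartialOrder P] :
    ∃ (π : ∀ n, (ChainP P n → ℤ) →ₗ[ℤ] (ChainP P n → ℤ))
      (h : ∀ n, (ChainP P (n + 1) → ℤ) →ₗ[ℤ] (ChainP P n → ℤ)),
      (∀ n, π (n + 1) ∘ₗ dLin P n = dLin P n ∘ₗ π n) ∧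
      (∀ x, π 0 x = h 0 (dLin P 0 x) + x) ∧
      (∀ n x, π (n + 1) x = dLin P n (h n x) + h (n + 1) (dLin P (n + 1) x) + x) ∧
      (∀ n (i : Fin (n + 1)) x c, π (n + 1) x (chainDegen i c) = 0) ∧
      (∀ x, π 0 x = x) ∧
      (∀ n x, (∀ (i : Fin (n + 1)) c, x (chainDegen i c) = 0) → π (n + 1) x = x) ∧
      (∀ n, dLin P (n + 1) ∘ₗ dLin P n = 0) := by
  let X := cochainObj P
  let H := homotopyPInftyToId X
  refine ⟨fun n => ((PInfty (X := X)).f n).unop.hom, fun n => (H.hom n (n + 1)).unop.hom,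
    ?_, ?_, ?_, ?_, ?_, ?_, ?_⟩
  · intro n
    rw [← dLin_eq]
    have := (PInfty (X := X)).comm (n + 1) n
    exact congrArg (fun f => f.unop.hom) this
  · intro x
    have := H.comm 0
    rw [Homotopy.dNext_zero_chainComplex, Homotopy.prevD_chainComplex, zero_add] at this
    rw [← dLin_eq]
    exact congrArg (fun f => f.unop.hom x) this
  · intro n x
    have := H.comm (n + 1)
    rw [Homotopy.dNext_succ_chainComplex, Homotopy.prevD_chainComplex] at this
    rw [← dLin_eq, ← dLin_eq]
    exact congrArg (fun f => f.unop.hom x) this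
  · intro n i x c
    have := σ_comp_PInfty X i
    exact congrFun (congrArg (fun f => f.unop.hom x) this) c
  · intro x
    rfl
  · intro n x hx
    have h1 := PInfty_f_add_QInfty_f (X := X) (n + 1)
    have h2 : (QInfty (X := X)).f (n + 1) = _ := decomposition_Q n (n + 1)
    have h3 : ((QInfty (X := X)).f (n + 1)).unop.hom x = 0 := by
      rw [h2]
      refine (unop_sum_apply (X := X _⦋n + 1⦌) (Y := X _⦋n + 1⦌) _ _ x).trans ?_
      refine Finset.sum_eq_zero fun i _ => ?_
      have : (X.σ (Fin.rev i)).unop.hom x = 0 := by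
        funext c
        exact hx _ c
      change ((AlgebraicTopology.DoldKan.P (X := X) i).f (n + 1)).unop.hom ((X.δ i.rev.succ).unop.hom
        ((X.σ (Fin.rev i)).unop.hom x)) = 0
      rw [this]
      simp
    have h4 := congrArg (fun f => f.unop.hom x) h1
    change ((PInfty (X := X)).f (n + 1)).unop.hom x
      + ((QInfty (X := X)).f (n + 1)).unop.hom x = x at h4
    rw [h3, add_zero] at h4
    exact h4
  · intro n
    rw [← dLin_eq, ← dLin_eq]
    have := (AlternatingFaceMapComplex.obj X).d_comp_d (n + 1 + 1) (n + 1) n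
    exact congrArg (fun f => f.unop.hom) this

theorem rank_nullity_aux {R : Type} [CommRing R] [IsDomain R]
    {M M' : Type} [AddCommGroup M] [AddCommGroup M'] [Module R M] [Module R M']
    [Module.Finite R M] (f : M →ₗ[R] M') :
    Module.finrank R (LinearMap.range f) + Module.finrank R (LinearMap.ker f) =
      Module.finrank R M := by
  rw [← f.quotKerEquivRange.finrank_eq]
  exact Submodule.finrank_quotient_add_finrank _

/-- Rank bookkeeping for a cochain complex with a homotopy-trivial complement. -/
theorem rank_normalization {R : Type} [CommRing R] [IsDomain R] [IsNoetherianRing R]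
    (C : ℕ → Type) [∀ n, AddCommGroup (C n)] [∀ n, Module R (C n)]
    [∀ n, Module.Finite R (C n)]
    (d : ∀ n, C n →ₗ[R] C (n + 1)) (π : ∀ n, C n →ₗ[R] C n) (h : ∀ n, C (n + 1) →ₗ[R] C n)
    (hdd : ∀ n, d (n + 1) ∘ₗ d n = 0)
    (hπd : ∀ n x, π (n + 1) (d n x) = d n (π n x))
    (hidem : ∀ n x, π n (π n x) = π n x)
    (h0 : ∀ x, π 0 x = h 0 (d 0 x) + x)
    (h1 : ∀ n x, π (n + 1) x = d n (h n x) + h (n + 1) (d (n + 1) x) + x)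
    (b : ℕ → ℕ)
    (hb0 : (b 0 : ℤ) = Module.finrank R (LinearMap.ker (d 0)))
    (hb : ∀ n, (b (n + 1) : ℤ) + Module.finrank R (LinearMap.range (d n)) =
      Module.finrank R (LinearMap.ker (d (n + 1))))
    (N : ℕ) (hN : ∀ x, π (N + 1) x = 0) :
    ∑ i ∈ Finset.range (N + 1), (-1 : ℤ) ^ i * (b i : ℤ) =
      ∑ i ∈ Finset.range (N + 1), (-1 : ℤ) ^ i *
        (Module.finrank R (LinearMap.range (π i)) : ℤ) := by
  -- ranks
  let s : ℕ → ℤ := fun n => Module.finrank R (LinearMap.range (π (n + 1) ∘ₗ d n))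
  let k : ℕ → ℤ := fun n => Module.finrank R ((LinearMap.ker (π n)).map (d n))
  have hc : ∀ n, (Module.finrank R (LinearMap.range (d n)) : ℤ)
      + Module.finrank R (LinearMap.ker (d n)) = Module.finrank R (C n) := fun n => by
    exact_mod_cast rank_nullity_aux (d n)
  have hp : ∀ n, (Module.finrank R (LinearMap.range (π n)) : ℤ)
      + Module.finrank R (LinearMap.ker (π n)) = Module.finrank R (C n) := fun n => by
    exact_mod_cast rank_nullity_aux (π n)
  have hr : ∀ n, (Module.finrank R (LinearMap.range (d n)) : ℤ) = s n + k n := by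
    intro n
    have e := rank_nullity_aux ((π (n + 1)).domRestrict (LinearMap.range (d n)))
    have e1 : LinearMap.range ((π (n + 1)).domRestrict (LinearMap.range (d n)))
        = LinearMap.range (π (n + 1) ∘ₗ d n) := by
      rw [LinearMap.range_domRestrict, LinearMap.range_comp]
    have e2 : (LinearMap.ker ((π (n + 1)).domRestrict (LinearMap.range (d n)))).map
        (LinearMap.range (d n)).subtype = (LinearMap.ker (π n)).map (d n) := by
      ext y
      constructor
      · rintro ⟨⟨_, ⟨x, rfl⟩⟩, hy, rfl⟩
        have hy : π (n + 1) (d n x) = 0 := hy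
        refine ⟨x - π n x, ?_, ?_⟩
        · simp [hidem]
        · simp [← hπd, hy]
      · rintro ⟨x, hx, rfl⟩
        have hx : π n x = 0 := hx
        refine ⟨⟨d n x, x, rfl⟩, ?_, rfl⟩
        change π (n + 1) (d n x) = 0
        rw [hπd, hx, map_zero]
    have e3 := rank_nullity_aux
      ((LinearMap.range (d n)).subtype.domRestrict
        (LinearMap.ker ((π (n + 1)).domRestrict (LinearMap.range (d n)))))
    have e4 : Module.finrank R (LinearMap.ker ((π (n + 1)).domRestrict (LinearMap.range (d n))))
        = Module.finrank R ((LinearMap.ker (π n)).map (d n)) := by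
      rw [← e2]
      exact (Submodule.equivMapOfInjective _ (Submodule.subtype_injective _) _).finrank_eq
    rw [e1, e4] at e
    simp only [s, k]
    exact_mod_cast e.symm
  have hker : ∀ n, (Module.finrank R (LinearMap.ker (π n)) : ℤ) = k n +
      Module.finrank R ((LinearMap.ker (π n) ⊓ LinearMap.ker (d n) : Submodule R (C n))) := by
    intro n
    have e := rank_nullity_aux ((d n).domRestrict (LinearMap.ker (π n)))
    rw [LinearMap.range_domRestrict] at e
    have e2 : (LinearMap.ker ((d n).domRestrict (LinearMap.ker (π n)))).map
        (LinearMap.ker (π n)).subtype = LinearMap.ker (π n) ⊓ LinearMap.ker (d n) := by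
      ext y
      constructor
      · rintro ⟨x, hx, rfl⟩
        exact ⟨x.2, hx⟩
      · rintro ⟨hx, hy⟩
        exact ⟨⟨y, hx⟩, hy, rfl⟩
    have e4 := (Submodule.equivMapOfInjective (LinearMap.ker (π n)).subtype
      (Submodule.subtype_injective _)
      (LinearMap.ker ((d n).domRestrict (LinearMap.ker (π n))))).finrank_eq
    rw [e2] at e4
    rw [e4] at e
    simp only [k]
    exact_mod_cast e.symm
  have hex0 : LinearMap.ker (π 0) ⊓ LinearMap.ker (d 0) = ⊥ := by
    rw [eq_bot_iff]
    rintro x ⟨hx, hy⟩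
    have hx : π 0 x = 0 := hx
    have hy : d 0 x = 0 := hy
    have := h0 x
    rw [hx, hy] at this
    simpa using this.symm
  have hex : ∀ n, LinearMap.ker (π (n + 1)) ⊓ LinearMap.ker (d (n + 1))
      = (LinearMap.ker (π n)).map (d n) := by
    intro n
    ext x
    constructor
    · rintro ⟨hx, hy⟩
      have hx : π (n + 1) x = 0 := hx
      have hy : d (n + 1) x = 0 := hy
      have e := h1 n x
      rw [hx, hy, map_zero, add_zero] at e
      have e' : x = - d n (h n x) := eq_neg_of_add_eq_zero_right e.symm
      refine ⟨-(h n x - π n (h n x)), ?_, ?_⟩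
      · simp [hidem]
      · rw [map_neg, map_sub, ← hπd]
        have : π (n + 1) (d n (h n x)) = 0 := by
          have e2 := congrArg (π (n + 1)) e'
          rw [hx, map_neg] at e2
          exact neg_eq_zero.mp e2.symm
        rw [this, sub_zero]
        exact e'.symm
    · rintro ⟨y, hy, rfl⟩
      have hy : π n y = 0 := hy
      refine ⟨?_, ?_⟩
      · change π (n + 1) (d n y) = 0
        rw [hπd, hy, map_zero]
      · exact LinearMap.congr_fun (hdd n) y
  have hB0 : (b 0 : ℤ) = Module.finrank R (LinearMap.range (π 0)) - s 0 := by
    have := hker 0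
    rw [hex0, finrank_bot] at this
    have h2 := hc 0
    have h3 := hp 0
    have h4 := hr 0
    push_cast at this
    linarith
  have hB : ∀ n, (b (n + 1) : ℤ) =
      Module.finrank R (LinearMap.range (π (n + 1))) - s (n + 1) - s n := by
    intro n
    have := hker (n + 1)
    rw [hex n] at this
    change _ = _ + k n at this
    have h2 := hc (n + 1)
    have h3 := hp (n + 1)
    have h4 := hr (n + 1)
    have h5 := hr n
    have h6 := hb n
    linarith
  have tele : ∀ M, ∑ i ∈ Finset.range (M + 1), (-1 : ℤ) ^ i * (b i : ℤ) =
      ∑ i ∈ Finset.range (M + 1), (-1 : ℤ) ^ i *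
        (Module.finrank R (LinearMap.range (π i)) : ℤ) - (-1) ^ M * s M := by
    intro M
    induction M with
    | zero => simp [hB0]
    | succ M ih =>
      rw [Finset.sum_range_succ, ih, Finset.sum_range_succ _ (M + 1), hB]
      ring
  rw [tele]
  have : s N = 0 := by
    have e : π (N + 1) ∘ₗ d N = 0 := LinearMap.ext fun x => hN _
    simp only [s]
    rw [e, LinearMap.range_zero, finrank_bot, Nat.cast_zero]
  rw [this]
  ring

theorem deg_lt_of_lt (G : GradedPoset P) {p q : P} (h : p < q) : G.deg q < G.deg p := by
  have hf : {r : P | p < r ∧ r ≤ q}.Finite :=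
    (G.finite_up p).subset fun r hr => hr.1.le
  obtain ⟨r, hr, hmin⟩ := hf.exists_minimal ⟨q, h, le_refl q⟩
  have := G.deg_step hr.1 (fun t ht1 ht2 => by
    rcases ht1.eq_or_lt with e | hlt
    · exact Or.inl e.symm
    · exact Or.inr (le_antisymm ht2 (hmin ⟨hlt, ht2.trans hr.2⟩ ht2)))
  have := G.deg_antitone hr.2
  omega

theorem mem_degFinset (G : GradedPoset P) (p q : P) (n : ℕ) :
    q ∈ degFinset G p n ↔ p ≤ q ∧ G.deg q = (n : ℤ) := by
  simp [degFinset, degSet]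

theorem Rnum_eq_zero (G : GradedPoset P) (p : P) (m : ℕ) (h : G.deg p < (m : ℤ)) :
    Rnum G m p = 0 := by
  induction m with
  | zero => have := G.deg_nonneg p; push_cast at h; omega
  | succ m ih =>
    rw [Rnum]
    rcases lt_or_eq_of_le (show G.deg p ≤ (m : ℤ) by push_cast at h; omega) with h1 | h1
    · rw [ih h1, sub_zero]
      refine Finset.sum_eq_zero fun q hq => ?_
      rw [mem_degFinset] at hq
      have := G.deg_antitone hq.1
      omega
    · have : degFinset G p m = {p} := by
        ext q
        rw [mem_degFinset, Finset.mem_singleton]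
        constructor
        · rintro ⟨h2, h3⟩
          rcases h2.eq_or_lt with e | hlt
          · exact e.symm
          · have := deg_lt_of_lt G hlt
            omega
        · rintro rfl
          exact ⟨le_refl _, h1⟩
      rw [this, Finset.sum_singleton, sub_self]

/-- The weight of an object. -/
noncomputable def wgt (G : GradedPoset P) (q : P) : ℤ :=
  (-1) ^ (G.deg q).toNat * Rnum G (G.deg q).toNat q

open Classical in
theorem sum_wgt_up [Fintype P] (G : GradedPoset P) (N : ℕ) (hN : ∀ p : P, G.deg p ≤ (N : ℤ))
    (p : P) : ∑ q with p ≤ q, wgt G q = 1 := by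
  have h1 : ∑ q with p ≤ q, wgt G q =
      ∑ i ∈ Finset.range (N + 1), (-1 : ℤ) ^ i * ∑ q ∈ degFinset G p i, Rnum G i q := by
    rw [← Finset.sum_fiberwise_of_maps_to (t := Finset.range (N + 1))
      (g := fun q => (G.deg q).toNat)]
    · refine Finset.sum_congr rfl fun i _ => ?_
      rw [Finset.mul_sum]
      have : Finset.filter (fun q => (G.deg q).toNat = i) (Finset.filter (fun q => p ≤ q) univ)
          = degFinset G p i := by
        ext q
        have := G.deg_nonneg q
        simp only [Finset.mem_filter, Finset.mem_univ, true_and, mem_degFinset]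
        refine and_congr_right fun _ => ?_
        omega
      rw [this]
      refine Finset.sum_congr rfl fun q hq => ?_
      rw [mem_degFinset] at hq
      rw [wgt, hq.2, Int.toNat_natCast]
    · intro q _
      have := hN q
      have := G.deg_nonneg q
      rw [Finset.mem_range]
      omega
  have h2 : ∀ M : ℕ, ∑ i ∈ Finset.range (M + 1), (-1 : ℤ) ^ i * ∑ q ∈ degFinset G p i, Rnum G i q
      = 1 + (-1) ^ M * Rnum G (M + 1) p := by
    intro M
    induction M with
    | zero => simp [Rnum]
    | succ M ih =>
      rw [Finset.sum_range_succ, ih]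
      conv_rhs => rw [Rnum]
      ring
  rw [h1, h2, Rnum_eq_zero G p (N + 1) (by have := hN p; push_cast; omega)]
  ring

theorem strictMono_fin_one (c : Fin (0 + 1) → P) : StrictMono c := by
  intro i j h
  have h : i.1 < j.1 := h
  omega

/-- Strict chains. -/
def SChain (P : Type) [PartialOrder P] (n : ℕ) : Type :=
  {c : Fin (n + 1) → P // StrictMono c}

noncomputable instance [Fintype P] (n : ℕ) : Fintype (SChain P n) := by
  classical
  exact Fintype.ofFinite {c : Fin (n + 1) → P // StrictMono c}

/-- Strict chains of length `n + 1` are strict chains of length `n` with a larger top. -/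
def schainEquiv (P : Type) [PartialOrder P] (n : ℕ) :
    SChain P (n + 1) ≃ (Σ c : SChain P n, {q : P // c.1 (Fin.last n) < q}) where
  toFun c := ⟨⟨fun i => c.1 i.castSucc, c.2.comp (Fin.strictMono_castSucc)⟩,
    ⟨c.1 (Fin.last (n + 1)), c.2 (Fin.castSucc_lt_last _)⟩⟩
  invFun x := ⟨Fin.snoc (α := fun _ => P) x.1.1 x.2.1, by
    rw [Fin.strictMono_iff_lt_succ]
    intro i
    induction i using Fin.lastCases with
    | last => 
      rw [Fin.succ_last, Fin.snoc_last, Fin.snoc_castSucc]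
      exact x.2.2
    | cast i =>
      rw [Fin.succ_castSucc, Fin.snoc_castSucc, Fin.snoc_castSucc]
      exact x.1.2 (Fin.castSucc_lt_succ)⟩
  left_inv c := by
    apply Subtype.ext
    funext i
    induction i using Fin.lastCases with
    | last => simp
    | cast i => simp
  right_inv x := by
    obtain ⟨⟨c, hc⟩, ⟨q, hq⟩⟩ := x
    have h1 : (fun i : Fin (n + 1) => Fin.snoc (α := fun _ => P) c q i.castSucc) = c := by
      funext i; simp
    have h2 : Fin.snoc (α := fun _ => P) c q (Fin.last (n + 1)) = q := by simp
    have key : ∀ (c' c'' : SChain P n) (q' q'' : P) (h' : c'.1 (Fin.last n) < q')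
        (h'' : c''.1 (Fin.last n) < q''), c' = c'' → q' = q'' →
        (⟨c', ⟨q', h'⟩⟩ : Σ c : SChain P n, {q : P // c.1 (Fin.last n) < q}) =
          ⟨c'', ⟨q'', h''⟩⟩ := by
      rintro c' _ q' _ h' _ rfl rfl
      rfl
    exact key _ _ _ _ _ _ (Subtype.ext h1) h2

theorem schain_isEmpty (G : GradedPoset P) (N : ℕ) (hN : ∀ p : P, G.deg p ≤ (N : ℤ))
    (c : Fin (N + 2) → P) (hc : StrictMono c) : False := by
  have : ∀ i : ℕ, ∀ hi : i < N + 2, G.deg (c ⟨i, hi⟩) ≤ N - i := by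
    intro i
    induction i with
    | zero => intro hi; simpa using hN _
    | succ i ih =>
      intro hi
      have h1 := ih (by omega)
      have h2 := deg_lt_of_lt G (hc (show (⟨i, by omega⟩ : Fin (N + 2)) < ⟨i + 1, hi⟩ by simp))
      push_cast
      omega
  have h1 := this (N + 1) (by omega)
  have h2 := G.deg_nonneg (c ⟨N + 1, by omega⟩)
  push_cast at h1
  omega

open Classical in
theorem euler_strict [Fintype P] (G : GradedPoset P) (N : ℕ)
    (hN : ∀ p : P, G.deg p ≤ (N : ℤ)) :
    ∑ i ∈ Finset.range (N + 1), (-1 : ℤ) ^ i * (Fintype.card (SChain P i) : ℤ) =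
      ∑ p : P, wgt G p := by
  let T : ℕ → ℤ := fun n => ∑ c : SChain P n, wgt G (c.1 (Fin.last n))
  have hT : ∀ n, (Fintype.card (SChain P n) : ℤ) = T n + T (n + 1) := by
    intro n
    have e : T (n + 1) = ∑ c : SChain P n, ∑ q : {q : P // c.1 (Fin.last n) < q}, wgt G q.1 := by
      rw [← Fintype.sum_sigma']
      exact Fintype.sum_equiv (schainEquiv P n) _ _ (fun c => rfl)
    rw [e]
    simp only [T]
    rw [← Finset.sum_add_distrib]
    rw [Fintype.card_eq_sum_ones]
    push_cast
    refine Finset.sum_congr rfl fun c _ => ?_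
    rw [← sum_wgt_up G N hN (c.1 (Fin.last n))]
    have : Finset.filter (fun q => c.1 (Fin.last n) ≤ q) univ =
        insert (c.1 (Fin.last n)) (Finset.filter (fun q => c.1 (Fin.last n) < q) univ) := by
      ext q
      simp [le_iff_eq_or_lt, eq_comm]
    rw [this, Finset.sum_insert (by simp), Finset.sum_subtype (p := fun q => c.1 (Fin.last n) < q)]
    simp
  have tele : ∀ M, ∑ i ∈ Finset.range (M + 1), (-1 : ℤ) ^ i * (Fintype.card (SChain P i) : ℤ) =
      T 0 + (-1) ^ M * T (M + 1) := by
    intro M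
    induction M with
    | zero => simp [hT]
    | succ M ih =>
      rw [Finset.sum_range_succ, ih, hT]
      ring
  have h0 : T (N + 1) = 0 := by
    refine Finset.sum_eq_zero fun c _ => ?_
    exact (schain_isEmpty G N hN c.1 c.2).elim
  rw [tele, h0, mul_zero, add_zero]
  let e : SChain P 0 ≃ P :=
    { toFun := fun c => c.1 (Fin.last 0)
      invFun := fun p => ⟨fun _ => p, strictMono_fin_one _⟩
      left_inv := fun c => Subtype.ext (funext fun i => congrArg c.1 (Fin.ext (by omega)))
      right_inv := fun p => rfl }
  exact Fintype.sum_equiv e _ _ (fun c => rfl)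

theorem finrank_vanishing {ι : Type} [Fintype ι] (p : ι → Prop) [Fintype {i // p i}]
    (V : Submodule ℤ (ι → ℤ)) (hV : ∀ x, x ∈ V ↔ ∀ i, ¬ p i → x i = 0) :
    Module.finrank ℤ V = Fintype.card {i // p i} := by
  classical
  let f : V →ₗ[ℤ] ({i // p i} → ℤ) := (LinearMap.funLeft ℤ ℤ Subtype.val) ∘ₗ V.subtype
  have hf : Function.Bijective f := by
    constructor
    · intro x y h
      apply Subtype.ext
      funext i
      by_cases hi : p i
      · exact congrFun h ⟨i, hi⟩
      · rw [(hV _).1 x.2 i hi, (hV _).1 y.2 i hi]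
    · intro y
      refine ⟨⟨fun i => if h : p i then y ⟨i, h⟩ else 0, (hV _).2 fun i hi => by simp [hi]⟩, ?_⟩
      funext i
      exact dif_pos i.2
  rw [(LinearEquiv.ofBijective f hf).finrank_eq, Module.finrank_fintype_fun_eq_card]

theorem cobarDiff_constZ (n : ℕ) (x : ChainP P n → ℤ) :
    (cobarDiff (constZ P) n x : ChainP P (n + 1) → ℤ) = dLin P n x := by
  funext c
  simp only [dLin, LinearMap.sum_apply, LinearMap.smul_apply, Finset.sum_apply, Pi.smul_apply]
  rfl

/-- The projection from cocycles to cohomology. -/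
noncomputable def toCoh (P : Type) [PartialOrder P] (n : ℕ) :
    LinearMap.ker (dLin P n) →ₗ[ℤ] cohomologyOf (constZ P) n where
  toFun x := QuotientAddGroup.mk (s := (cobarCoboundaries (constZ P) n).addSubgroupOf
    (cobarDiff (constZ P) n).ker) ⟨x.1, (cobarDiff_constZ n x.1).trans x.2⟩
  map_add' _ _ := rfl
  map_smul' _ _ := rfl

theorem toCoh_surjective (n : ℕ) : Function.Surjective (toCoh P n) := by
  intro y
  obtain ⟨x, rfl⟩ := QuotientAddGroup.mk_surjective y
  exact ⟨⟨x.1, (cobarDiff_constZ n x.1).symm.trans x.2⟩, rfl⟩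

theorem toCoh_eq_zero (n : ℕ) (x : LinearMap.ker (dLin P n)) :
    toCoh P n x = 0 ↔ x.1 ∈ cobarCoboundaries (constZ P) n := by
  refine (QuotientAddGroup.eq_zero_iff _).trans ?_
  exact AddSubgroup.mem_addSubgroupOf

theorem betti_zero [Fintype P] [∀ n, Finite (ChainP P n)] :
    (bettiOf (constZ P) 0 : ℤ) = Module.finrank ℤ (LinearMap.ker (dLin P 0)) := by
  have hk : LinearMap.ker (toCoh P 0) = ⊥ := by
    rw [eq_bot_iff]
    intro x hx
    have := (toCoh_eq_zero 0 x).1 hx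
    exact Subtype.ext this
  have := rank_nullity_aux (toCoh P 0)
  rw [hk, finrank_bot, LinearMap.range_eq_top.2 (toCoh_surjective 0), finrank_top] at this
  rw [bettiOf]
  exact_mod_cast this

theorem betti_succ [Fintype P] [∀ n, Finite (ChainP P n)]
    (hdd : ∀ n, dLin P (n + 1) ∘ₗ dLin P n = 0) (n : ℕ) :
    (bettiOf (constZ P) (n + 1) : ℤ) + Module.finrank ℤ (LinearMap.range (dLin P n)) =
      Module.finrank ℤ (LinearMap.ker (dLin P (n + 1))) := by
  have hk : (LinearMap.ker (toCoh P (n + 1))).map (LinearMap.ker (dLin P (n + 1))).subtype =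
      LinearMap.range (dLin P n) := by
    ext y
    constructor
    · rintro ⟨x, hx, rfl⟩
      obtain ⟨z, hz⟩ := (toCoh_eq_zero (n + 1) x).1 hx
      exact ⟨z, (cobarDiff_constZ n z).symm.trans hz⟩
    · rintro ⟨z, rfl⟩
      refine ⟨⟨dLin P n z, LinearMap.congr_fun (hdd n) z⟩, ?_, rfl⟩
      exact (toCoh_eq_zero (n + 1) _).2 ⟨z, cobarDiff_constZ n z⟩
  have e := (Submodule.equivMapOfInjective (LinearMap.ker (dLin P (n + 1))).subtype
    (Submodule.subtype_injective _) (LinearMap.ker (toCoh P (n + 1)))).finrank_eq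
  rw [hk] at e
  have := rank_nullity_aux (toCoh P (n + 1))
  rw [e, LinearMap.range_eq_top.2 (toCoh_surjective (n + 1)), finrank_top] at this
  rw [bettiOf]
  exact_mod_cast this

theorem exists_degen (n : ℕ) (c : ChainP P (n + 1)) (hc : ¬ StrictMono c.1) :
    ∃ (i : Fin (n + 1)) (c' : ChainP P n), c = chainDegen i c' := by
  rw [Fin.strictMono_iff_lt_succ] at hc
  push Not at hc
  obtain ⟨i, hi⟩ := hc
  have hi : c.1 i.castSucc = c.1 i.succ := by
    by_contra h
    exact hi (lt_of_le_of_ne (c.2 (Fin.castSucc_lt_succ).le) h)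
  refine ⟨i, chainFace i.castSucc c, Subtype.ext ?_⟩
  funext j
  change c.1 j = c.1 (i.castSucc.succAbove (i.predAbove j))
  by_cases hj : j = i.castSucc
  · subst hj
    simp [hi]
  · rw [Fin.succAbove_predAbove hj]

theorem chainDegen_not_strict (n : ℕ) (i : Fin (n + 1)) (c : ChainP P n) :
    ¬ StrictMono (chainDegen i c).1 := by
  intro h
  have := h (Fin.castSucc_lt_succ (i := i))
  simp [chainDegen] at this

theorem euler_betti [Fintype P] (G : GradedPoset P) (N : ℕ)
    (hN : ∀ p : P, G.deg p ≤ (N : ℤ)) :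
    ∑ i ∈ Finset.range (N + 1), (-1 : ℤ) ^ i * (bettiOf (constZ P) i : ℤ) =
      ∑ i ∈ Finset.range (N + 1), (-1 : ℤ) ^ i * (Fintype.card (SChain P i) : ℤ) := by
  classical
  have : ∀ n, Finite (ChainP P n) := fun n =>
    inferInstanceAs (Finite {c : Fin (n + 1) → P // Monotone c})
  obtain ⟨π, h, hπd, h0, h1, hvan, hid0, hid, hdd⟩ := exists_normalization P
  have hv : ∀ n x (c : ChainP P n), ¬ StrictMono c.1 → π n x c = 0 := by
    intro n x c hc
    cases n with
    | zero => exact (hc (strictMono_fin_one c.1)).elim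
    | succ n =>
      obtain ⟨i, c', rfl⟩ := exists_degen n c hc
      exact hvan n i x c'
  have hf : ∀ n x, (∀ c : ChainP P n, ¬ StrictMono c.1 → x c = 0) → π n x = x := by
    intro n x hx
    cases n with
    | zero => exact hid0 x
    | succ n => exact hid n x fun i c => hx _ (chainDegen_not_strict n i c)
  rw [rank_normalization (fun n => ChainP P n → ℤ) (dLin P) π h hdd
    (fun n x => LinearMap.congr_fun (hπd n) x) (fun n x => hf n _ (hv n x)) h0 h1
    (bettiOf (constZ P)) betti_zero (betti_succ hdd) N
    (fun x => funext fun c => hv _ x c fun hc => schain_isEmpty G N hN c.1 hc)]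
  refine Finset.sum_congr rfl fun n _ => ?_
  congr 2
  have : Fintype (ChainP P n) := Fintype.ofFinite _
  rw [finrank_vanishing (fun c : ChainP P n => StrictMono c.1)]
  · refine Fintype.card_congr
      { toFun := fun c => ⟨c.1.1, c.2⟩
        invFun := fun c => ⟨⟨c.1, c.2.monotone⟩, c.2⟩
        left_inv := fun c => rfl
        right_inv := fun c => rfl }
  · intro x
    constructor
    · rintro ⟨y, rfl⟩ c hc
      exact hv n y c hc
    · intro hx
      exact ⟨x, hf n x hx⟩

/-- **Lemma 4.5.** Let `𝒫` be a graded poset for which there exists an adequate local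
covering family (with finitely many objects in each degree, all degrees bounded by `N`).
Then `Σ_i (−1)^i rk H^i(𝒫; ℤ) = Σ_i (−1)^i Σ_{p ∈ Ob_i 𝒫} R_i^p`. -/
theorem lemma_4_5 {P : Type} [PartialOrder P] (G : GradedPoset P) (J : P → ℕ → Set P)
    (hJ : IsAdequate G J) (hfin : ∀ i : ℤ, {p : P | G.deg p = i}.Finite)
    (N : ℕ) (hN : ∀ p : P, G.deg p ≤ (N : ℤ)) :
    ∑ i ∈ Finset.range (N + 1), (-1 : ℤ) ^ i * (bettiOf (constZ P) i : ℤ) =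
      ∑ i ∈ Finset.range (N + 1), (-1 : ℤ) ^ i * ∑ p ∈ obFinset G hfin i, Rnum G i p := by
  classical
  have : Finite P := by
    rw [← Set.finite_univ_iff]
    refine ((Set.finite_Icc (0 : ℤ) N).biUnion fun i _ => hfin i).subset fun p _ => ?_
    exact Set.mem_biUnion (Set.mem_Icc.2 ⟨G.deg_nonneg p, hN p⟩) rfl
  have : Fintype P := Fintype.ofFinite P
  rw [euler_betti G N hN, euler_strict G N hN,
    ← Finset.sum_fiberwise_of_maps_to (t := Finset.range (N + 1)) (g := fun q => (G.deg q).toNat)]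
  · refine Finset.sum_congr rfl fun i _ => ?_
    rw [Finset.mul_sum]
    have : Finset.filter (fun q => (G.deg q).toNat = i) univ = obFinset G hfin i := by
      ext q
      have := G.deg_nonneg q
      simp only [Finset.mem_filter, Finset.mem_univ, true_and, obFinset, Set.Finite.mem_toFinset,
        Set.mem_setOf_eq]
      omega
    rw [this]
    refine Finset.sum_congr rfl fun q hq => ?_
    simp only [obFinset, Set.Finite.mem_toFinset, Set.mem_setOf_eq] at hq
    rw [wgt, hq, Int.toNat_natCast]
  · intro q _
    have := hN q
    have := G.deg_nonneg q
    rw [Finset.mem_range]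
    omega
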